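/- The set Σ_n of all elements t_{i_1}^{k_1} t_{i_2}^{k_2} ⋯ t_{i_r}^{k_r} · σ, where r ≥ 0, 0 ≤ i_1 < i_2 < ⋯ < i_r ≤ n−1, k_1, …, k_r ∈ ℤ∖{0}, and σ ranges over the Jones basis S_n of H_n(q), is a basis of H_{1,n}(q) as an R-module. -/

import Mathlib

set_option synthInstance.maxHeartbeats 1000000
set_option maxHeartbeats 2000000

namespace MB

/-! ## The mixed braid group `B_{1,n}` (with `m = n - 1` braiding generators) -/

/-- Generators: `none` is the looping generator `t`, `some i` is `σ_{i+1}` for `i : Fin m`. -/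
abbrev MBGen (m : ℕ) := Option (Fin m)

/-- The relators of the mixed braid group `B_{1,n}` (`m = n-1`):
`σ₁tσ₁t = tσ₁tσ₁`; `tσ_i = σ_i t` for `i > 1`; the braid relations among the `σ_i`. -/
def rels (m : ℕ) : Set (FreeGroup (MBGen m)) :=
  { r | (∃ h : 0 < m,
          r = (FreeGroup.of (some ⟨0, h⟩) * FreeGroup.of none) ^ 2 *
              ((FreeGroup.of (none : MBGen m) * FreeGroup.of (some ⟨0, h⟩)) ^ 2)⁻¹) ∨
        (∃ i : Fin m, 1 ≤ (i : ℕ) ∧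
          r = FreeGroup.of (none : MBGen m) * FreeGroup.of (some i) *
              (FreeGroup.of (some i) * FreeGroup.of (none : MBGen m))⁻¹) ∨
        (∃ i j : Fin m, (i : ℕ) + 1 = (j : ℕ) ∧
          r = FreeGroup.of (some i) * FreeGroup.of (some j) * FreeGroup.of (some i) *
              (FreeGroup.of (some j) * FreeGroup.of (some i) * FreeGroup.of (some j))⁻¹) ∨
        (∃ i j : Fin m, (i : ℕ) + 1 < (j : ℕ) ∧
          r = FreeGroup.of (some i) * FreeGroup.of (some j) *
              (FreeGroup.of (some j) * FreeGroup.of (some i))⁻¹) }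

/-- The mixed braid group `B_{1,n}` with `n = m+1` moving strands. -/
abbrev B (m : ℕ) := PresentedGroup (rels m)

/-- The braiding generator `σ_{i+1}`, for `i : Fin m`. -/
def σ {m : ℕ} (i : Fin m) : B m := PresentedGroup.of (some i)

/-- The looping generator `t`. -/
def τ {m : ℕ} : B m := PresentedGroup.of none

/-- `σ_j` in one-based indexing (`1 ≤ j ≤ m`), junk value `1` out of range. -/
def sig {m : ℕ} (j : ℕ) : B m :=
  if h : 1 ≤ j ∧ j - 1 < m then σ ⟨j - 1, h.2⟩ else 1

/-- The looping elements `t_i = σ_i ⋯ σ_1 t σ_1 ⋯ σ_i` (for `0 ≤ i ≤ m`), via `t_0 = t`,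
`t_{j+1} = σ_{j+1} t_j σ_{j+1}`. -/
def tt {m : ℕ} : ℕ → B m
  | 0 => τ
  | (j+1) => sig (j+1) * tt j * sig (j+1)

/-- The looping elements `t′_i = σ_i ⋯ σ_1 t σ_1⁻¹ ⋯ σ_i⁻¹` (for `0 ≤ i ≤ m`), via `t′_0 = t`,
`t′_{j+1} = σ_{j+1} t′_j σ_{j+1}⁻¹`. -/
def tp {m : ℕ} : ℕ → B m
  | 0 => τ
  | (j+1) => sig (j+1) * tp j * (sig (j+1))⁻¹

/-! ## The generalized Iwahori–Hecke algebra of type B, `H_{1,n}(q)` -/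

/-- The ground ring `R = ℂ[q^{±1}]` of Laurent polynomials. -/
abbrev R : Type := LaurentPolynomial ℂ

instance : IsDomain R := NoZeroDivisors.to_isDomain _

/-- The variable `q ∈ R`. -/
noncomputable def qq : R := LaurentPolynomial.T 1

/-- The quadratic Hecke relations `σ_i² = (q-1)σ_i + q`. -/
inductive heckeRel (m : ℕ) :
    MonoidAlgebra R (B m) → MonoidAlgebra R (B m) → Prop
  | quad (i : Fin m) : heckeRel m
      (MonoidAlgebra.of R (B m) (σ i) * MonoidAlgebra.of R (B m) (σ i))
      ((qq - 1) • MonoidAlgebra.of R (B m) (σ i) + qq • (1 : MonoidAlgebra R (B m)))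

/-- The generalized Iwahori–Hecke algebra of type B, `H_{1,n}(q)` (`n = m+1`), as the quotient
of the group algebra `R[B_{1,n}]` by the two-sided ideal generated by the quadratic relations. -/
abbrev H (m : ℕ) := RingQuot (heckeRel m)

/-- The canonical multiplicative map `π : B_{1,n} → H_{1,n}(q)`. -/
noncomputable def pih (m : ℕ) : B m →* H m :=
  (RingQuot.mkRingHom (heckeRel m)).toMonoidHom.comp (MonoidAlgebra.of R (B m))

/-- The subalgebra `H_n(q)` of `H_{1,n}(q)` generated by the images `g_1, …, g_{n-1}`
of `σ_1, …, σ_{n-1}`. -/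
noncomputable def HA (m : ℕ) : Subalgebra R (H m) :=
  Algebra.adjoin R (Set.range fun i : Fin m => pih m (σ i))

/-! ## Jones-basis words -/

/-- The descending product `σ_i σ_{i−1} ⋯ σ_{i−k}` (one-based indices). -/
def desc {m : ℕ} (i : ℕ) : ℕ → B m
  | 0 => sig i
  | (k+1) => desc i k * sig (i - (k+1))

/-- A Jones-basis word: a product `(σ_{i_1} ⋯ σ_{i_1−k_1}) ⋯ (σ_{i_p} ⋯ σ_{i_p−k_p})`
with `1 ≤ i_1 < ⋯ < i_p ≤ m` and `0 ≤ k_j ≤ i_j − 1`, including the empty word. -/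
def JonesWord {m : ℕ} (w : B m) : Prop :=
  ∃ (p : ℕ) (i : Fin p → ℕ) (k : Fin p → ℕ),
    StrictMono i ∧ (∀ j, 1 ≤ i j ∧ i j ≤ m) ∧ (∀ j, k j ≤ i j - 1) ∧
      w = (List.ofFn fun j => desc (i j) (k j)).prod

/-- The set `Σ_n ⊆ H_{1,n}(q)` of elements `t_{i_1}^{k_1} ⋯ t_{i_r}^{k_r} · σ` with
`0 ≤ i_1 < ⋯ < i_r ≤ n−1`, nonzero integer exponents, and `σ` in the Jones basis of `H_n(q)`. -/
noncomputable def SigmaSet (m : ℕ) : Set (H m) :=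
  { x | ∃ (r : ℕ) (ind : Fin r → ℕ) (ke : Fin r → ℤ) (w : B m),
      StrictMono ind ∧ (∀ j, ind j ≤ m) ∧ (∀ j, ke j ≠ 0) ∧ JonesWord w ∧
      x = pih m ((List.ofFn fun j => tt (ind j) ^ ke j).prod * w) }

/-! ## A representation on a free module -/

/-- Index set of the basis of the representation. -/
abbrev X := ℕ → ℤ

abbrev MM := X →₀ R

/-- place transposition -/
def sw (i : ℕ) (a : X) : X := a ∘ (Equiv.swap i (i+1))

lemma sw_sw (i : ℕ) (a : X) : sw i (sw i a) = a := by
  funext j; simp [sw]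

def swp (i : ℕ) : Equiv.Perm X := ⟨sw i, sw i, sw_sw i, sw_sw i⟩

/-- value of `g_i` on a basis vector -/
noncomputable def gv (i : ℕ) (a : X) : MM :=
  if a i < a (i+1) then Finsupp.single (sw i a) 1
  else if a i = a (i+1) then qq • Finsupp.single a 1
  else qq • Finsupp.single (sw i a) 1 + (qq - 1) • Finsupp.single a 1

noncomputable def gl (i : ℕ) : Module.End R MM := Finsupp.linearCombination R (gv i)

lemma gl_single (i : ℕ) (a : X) : gl i (Finsupp.single a 1) = gv i a := by
  simp [gl]

lemma sw_l (i : ℕ) (a : X) : sw i a i = a (i+1) := by simp [sw]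
lemma sw_r (i : ℕ) (a : X) : sw i a (i+1) = a i := by simp [sw]
lemma sw_o (i j : ℕ) (a : X) (h : j ≠ i) (h' : j ≠ i + 1) : sw i a j = a j := by
  simp [sw, Equiv.swap_apply_of_ne_of_ne h h']

lemma sw_eq (i : ℕ) (a : X) (h : a i = a (i+1)) : sw i a = a := by
  funext j
  by_cases h1 : j = i
  · subst h1; rw [sw_l, h]
  by_cases h2 : j = i + 1
  · subst h2; rw [sw_r, h]
  rw [sw_o _ _ _ h1 h2]

lemma sw_ite (i j : ℕ) (a : X) :
    sw i a j = if j = i then a (i+1) else if j = i + 1 then a i else a j := by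
  split_ifs with h h'
  · rw [h, sw_l]
  · rw [h', sw_r]
  · exact sw_o _ _ _ h h'

lemma sw_braid (i : ℕ) (a : X) : sw i (sw (i+1) (sw i a)) = sw (i+1) (sw i (sw (i+1) a)) := by
  funext j
  simp only [sw_ite]
  split_ifs <;> first | rfl | omega

lemma sw_comm (i j : ℕ) (hij : i + 1 < j) (a : X) : sw i (sw j a) = sw j (sw i a) := by
  funext k
  simp only [sw_ite]
  split_ifs <;> first | rfl | omega

lemma gv_lt {i : ℕ} {a : X} (h : a i < a (i+1)) : gv i a = Finsupp.single (sw i a) 1 := by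
  simp [gv, h]
lemma gv_eq {i : ℕ} {a : X} (h : a i = a (i+1)) : gv i a = qq • Finsupp.single a 1 := by
  simp [gv, h]
lemma gv_gt {i : ℕ} {a : X} (h : a (i+1) < a i) :
    gv i a = qq • Finsupp.single (sw i a) 1 + (qq - 1) • Finsupp.single a 1 := by
  simp [gv, h.not_gt, h.ne']

lemma gl_quad (i : ℕ) : gl i * gl i = (qq - 1) • gl i + qq • 1 := by
  ext1 a
  ext1
  simp only [LinearMap.comp_apply, Finsupp.lsingle_apply, Module.End.mul_apply, LinearMap.add_apply,
    LinearMap.smul_apply, Module.End.one_apply, gl_single]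
  rcases lt_trichotomy (a i) (a (i+1)) with h | h | h
  · rw [gv_lt h, gl_single, gv_gt (by simpa [sw_l, sw_r] using h), sw_sw]; abel
  · simp only [gv_eq h, map_smul, gl_single]; module
  · simp only [gv_gt h, map_smul, map_add, gl_single]
    rw [gv_lt (by simpa [sw_l, sw_r] using h), sw_sw]; module

lemma gl_lt {i : ℕ} {a : X} (h : a i < a (i+1)) :
    gl i (Finsupp.single a 1) = Finsupp.single (sw i a) 1 := by
  rw [gl_single, gv_lt h]
lemma gl_eq {i : ℕ} {a : X} (h : a i = a (i+1)) :
    gl i (Finsupp.single a 1) = qq • Finsupp.single a 1 := by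
  rw [gl_single, gv_eq h]
lemma gl_gt {i : ℕ} {a : X} (h : a (i+1) < a i) : gl i (Finsupp.single a 1) =
    qq • Finsupp.single (sw i a) 1 + (qq - 1) • Finsupp.single a 1 := by
  rw [gl_single, gv_gt h]

lemma gl_comm (i j : ℕ) (hij : i + 1 < j) : gl i * gl j = gl j * gl i := by
  ext1 a
  ext1
  simp only [LinearMap.comp_apply, Finsupp.lsingle_apply, Module.End.mul_apply]
  have e1 : sw j a i = a i := sw_o _ _ _ (by omega) (by omega)
  have e2 : sw j a (i+1) = a (i+1) := sw_o _ _ _ (by omega) (by omega)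
  have e3 : sw i a j = a j := sw_o _ _ _ (by omega) (by omega)
  have e4 : sw i a (j+1) = a (j+1) := sw_o _ _ _ (by omega) (by omega)
  have e5 := sw_comm i j hij a
  rcases lt_trichotomy (a i) (a (i+1)) with h | h | h <;>
  rcases lt_trichotomy (a j) (a (j+1)) with h' | h' | h' <;>
  simp (disch := simp [e1, e2, e3, e4, h, h']) only [gl_lt, gl_eq, gl_gt, map_add, map_smul, e5] <;>
  module

lemma gl_braid (i : ℕ) : gl i * gl (i+1) * gl i = gl (i+1) * gl i * gl (i+1) := by
  ext1 a
  ext1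
  simp only [LinearMap.comp_apply, Finsupp.lsingle_apply, Module.End.mul_apply]
  have e1 := sw_l i
  have e2 := sw_r i
  have e3 : ∀ a, sw i a (i+1+1) = a (i+1+1) := fun a => sw_o _ _ _ (by omega) (by omega)
  have f1 := sw_l (i+1)
  have f2 := sw_r (i+1)
  have f3 : ∀ a, sw (i+1) a i = a i := fun a => sw_o _ _ _ (by omega) (by omega)
  have e5 := sw_braid i
  rcases lt_trichotomy (a i) (a (i+1)) with h | h | h <;>
  rcases lt_trichotomy (a (i+1)) (a (i+1+1)) with h' | h' | h' <;>
  rcases lt_trichotomy (a i) (a (i+1+1)) with h'' | h'' | h'' <;>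
  first
  | (exfalso; omega)
  | (simp (disch := first | omega | (simp only [e1, e2, e3, f1, f2, f3]; omega)) only
      [gl_lt, gl_eq, gl_gt, map_add, map_smul, e5, sw_sw]
     try have k1 := sw_eq i a (by omega)
     try have k2 := sw_eq (i+1) a (by omega)
     try have k3 := sw_eq i (sw (i+1) a) (by simp only [e1, e2, e3, f1, f2, f3]; omega)
     try have k4 := sw_eq (i+1) (sw i a) (by simp only [e1, e2, e3, f1, f2, f3]; omega)
     try simp only [k1, k2, k3, k4]
     try module)

/-! ## Type B relations from the cyclic presentation -/

section abs
variable {G : Type*} [Group G] (s : ℕ → G) (ρ : G) (m : ℕ)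

/-- `s_{k-1}⁻¹ ⋯ s_0⁻¹` -/
def EE : ℕ → G
  | 0 => 1
  | (k+1) => (s k)⁻¹ * EE k

lemma EE_comm (hc : ∀ i j, i + 1 < j → s i * s j = s j * s i) (j k : ℕ) (h : k < j) :
    Commute (EE s k) (s j) := by
  induction k with
  | zero => exact Commute.one_left _
  | succ k ih =>
    exact Commute.mul_left (Commute.inv_left (hc k j (by omega))) (ih (by omega))

lemma EE_shift (hc : ∀ i j, i + 1 < j → s i * s j = s j * s i)
    (hb : ∀ i, s i * s (i+1) * s i = s (i+1) * s i * s (i+1)) (i k : ℕ) (h : i + 1 < k) :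
    EE s k * s (i+1) = s i * EE s k := by
  induction k with
  | zero => omega
  | succ k ih =>
    rcases Nat.lt_or_ge (i+1) k with h1 | h1
    · rw [EE, mul_assoc, ih h1, ← mul_assoc, ← mul_assoc,
        (Commute.inv_left (show Commute (s k) (s i) from (hc i k h1).symm)).eq]
    · have : k = i + 1 := by omega
      subst this
      rw [EE, EE, mul_assoc, mul_assoc, (EE_comm s hc (i+1) i (by omega)).eq]
      have hb' : (s (i+1))⁻¹ * (s i)⁻¹ * s (i+1) = s i * (s (i+1))⁻¹ * (s i)⁻¹ := by
        rw [eq_mul_inv_iff_mul_eq, eq_mul_inv_iff_mul_eq, mul_assoc, mul_assoc, mul_assoc,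
          inv_mul_eq_iff_eq_mul, inv_mul_eq_iff_eq_mul]
        have := hb i
        simp only [mul_assoc] at this ⊢
        rw [this]
      simp only [← mul_assoc, hb']

lemma EE_c (hr : ∀ i, i + 1 < m → ρ * s i = s (i+1) * ρ) (k : ℕ) (h : k < m) :
    EE s (k+1) = ρ * EE s k * ρ⁻¹ * (s 0)⁻¹ := by
  induction k with
  | zero => simp [EE]
  | succ k ih =>
    have : (s (k+1))⁻¹ * ρ = ρ * (s k)⁻¹ := by
      rw [inv_mul_eq_iff_eq_mul, ← mul_assoc, eq_mul_inv_iff_mul_eq, hr k h]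
    calc EE s (k+1+1) = (s (k+1))⁻¹ * EE s (k+1) := rfl
      _ = (s (k+1))⁻¹ * (ρ * EE s k * ρ⁻¹ * (s 0)⁻¹) := by rw [ih (by omega)]
      _ = ρ * ((s k)⁻¹ * EE s k) * ρ⁻¹ * (s 0)⁻¹ := by simp only [← mul_assoc, this]

lemma EE_d (hc : ∀ i j, i + 1 < j → s i * s j = s j * s i)
    (hb : ∀ i, s i * s (i+1) * s i = s (i+1) * s i * s (i+1))
    (hr : ∀ i, i + 1 < m → ρ * s i = s (i+1) * ρ) (k : ℕ) (h : k < m) :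
    EE s m * (ρ * EE s k * ρ⁻¹) = EE s k * EE s m := by
  induction k with
  | zero => simp [EE]
  | succ k ih =>
    have h1 : ρ * (s k)⁻¹ = (s (k+1))⁻¹ * ρ := by
      rw [eq_comm, inv_mul_eq_iff_eq_mul, ← mul_assoc, eq_mul_inv_iff_mul_eq, hr k h]
    have h2 : EE s m * (s (k+1))⁻¹ = (s k)⁻¹ * EE s m := by
      rw [eq_comm, inv_mul_eq_iff_eq_mul, ← mul_assoc, eq_mul_inv_iff_mul_eq,
        EE_shift s hc hb k m h]
    have := ih (by omega)
    simp only [EE]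
    simp only [← mul_assoc, h1, h2] at this ⊢
    rw [mul_assoc _ (EE s m) ρ, mul_assoc _ (EE s m * ρ), mul_assoc _ (EE s m * ρ * EE s k), this]
    simp only [mul_assoc]

lemma EE_B (hc : ∀ i j, i + 1 < j → s i * s j = s j * s i)
    (hb : ∀ i, s i * s (i+1) * s i = s (i+1) * s i * s (i+1))
    (hr : ∀ i, i + 1 < m → ρ * s i = s (i+1) * ρ)
    (hr2 : ∀ k, m = k + 1 → ρ * ρ * s k = s 0 * (ρ * ρ)) (hm : 0 < m) :
    (s 0 * (ρ * EE s m)) ^ 2 = ((ρ * EE s m) * s 0) ^ 2 := by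
  obtain ⟨k, rfl⟩ : ∃ k, m = k + 1 := ⟨m - 1, by omega⟩
  have h1 := EE_c s ρ (k+1) hr k (by omega)
  have h2 := EE_d s ρ (k+1) hc hb hr k (by omega)
  have h3 := hr2 k rfl
  set F := ρ * EE s k * ρ⁻¹ with hF
  have hFr : F * ρ = ρ * EE s k := by simp [hF]
  have h4 : ρ * EE s (k+1) * s 0 = ρ * F := by rw [h1]; group
  have h5 : EE s (k+1) = (s k)⁻¹ * EE s k := rfl
  rw [pow_two, pow_two, h4]
  have h6 : ρ * F * (ρ * F) = ρ * ρ * (EE s k * F) := by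
    rw [mul_assoc, ← mul_assoc F, hFr]; simp only [mul_assoc]
  rw [h6]
  calc s 0 * (ρ * EE s (k+1)) * (s 0 * (ρ * EE s (k+1)))
      = s 0 * (ρ * EE s (k+1) * s 0) * (ρ * EE s (k+1) * s 0) * (s 0)⁻¹ := by group
    _ = s 0 * (ρ * F * (ρ * F)) * (s 0)⁻¹ := by rw [h4]; simp only [mul_assoc]
    _ = s 0 * (ρ * ρ) * (EE s k * (F * (s 0)⁻¹)) := by rw [h6]; simp only [mul_assoc]
    _ = ρ * ρ * s k * (EE s k * EE s (k+1)) := by rw [h3, ← h1]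
    _ = ρ * ρ * s k * ((s k)⁻¹ * EE s k * F) := by rw [← h2, ← h5]
    _ = _ := by simp only [mul_assoc, mul_inv_cancel_left]

lemma EE_t (hc : ∀ i j, i + 1 < j → s i * s j = s j * s i)
    (hb : ∀ i, s i * s (i+1) * s i = s (i+1) * s i * s (i+1))
    (hr : ∀ i, i + 1 < m → ρ * s i = s (i+1) * ρ) (i : ℕ) (hi : i + 1 < m) :
    (ρ * EE s m) * s (i+1) = s (i+1) * (ρ * EE s m) := by
  rw [mul_assoc, EE_shift s hc hb i m hi, ← mul_assoc, hr i hi, mul_assoc]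

/-- The homomorphism out of the mixed braid group. -/
def homB (m : ℕ) (hc : ∀ i j, i + 1 < j → s i * s j = s j * s i)
    (hb : ∀ i, s i * s (i+1) * s i = s (i+1) * s i * s (i+1))
    (hr : ∀ i, i + 1 < m → ρ * s i = s (i+1) * ρ)
    (hr2 : ∀ k, m = k + 1 → ρ * ρ * s k = s 0 * (ρ * ρ)) : B m →* G :=
  PresentedGroup.toGroup (rels := rels m)
    (f := fun x : MBGen m => Option.elim x (ρ * EE s m) (fun i => s (i : ℕ))) (by
    rintro r (⟨h, rfl⟩ | ⟨i, h, rfl⟩ | ⟨i, j, h, rfl⟩ | ⟨i, j, h, rfl⟩)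
    · simp [EE_B s ρ m hc hb hr hr2 h]
    · obtain ⟨k, hk⟩ : ∃ k, (i : ℕ) = k + 1 := ⟨i - 1, by omega⟩
      have := i.2
      simp only [map_mul, map_inv, FreeGroup.lift_apply_of, Option.elim, hk]
      rw [mul_inv_eq_one]
      exact EE_t s ρ m hc hb hr k (by omega)
    · simp [← h, hb]
    · simp [hc _ _ h])

end abs

lemma homB_σ {G : Type*} [Group G] (s : ℕ → G) (ρ : G) (m : ℕ) (hc hb hr hr2) (i : Fin m) :
    homB s ρ m hc hb hr hr2 (σ i) = s i := by
  simp [homB, σ]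

lemma homB_τ {G : Type*} [Group G] (s : ℕ → G) (ρ : G) (m : ℕ) (hc hb hr hr2) :
    homB s ρ m hc hb hr hr2 τ = ρ * EE s m := by
  simp [homB, τ]

/-- cyclic shift -/
def rho (m : ℕ) (a : X) : X := fun j =>
  if j = 0 then a m + (m+1) else if j ≤ m then a (j-1) else a j

def rhoi (m : ℕ) (a : X) : X := fun j =>
  if j < m then a (j+1) else if j = m then a 0 - (m+1) else a j

def rhop (m : ℕ) : Equiv.Perm X where
  toFun := rho m
  invFun := rhoi m
  left_inv a := by
    funext j
    simp only [rho, rhoi]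
    split_ifs <;> first | contradiction | omega | rfl | (congr 1; omega) | simp_all
  right_inv a := by
    funext j
    simp only [rho, rhoi]
    split_ifs <;> first | contradiction | omega | rfl | (congr 1; omega) | simp_all

lemma rho_sw (m i : ℕ) (h : i + 1 < m) (a : X) : rho m (sw i a) = sw (i+1) (rho m a) := by
  funext j
  simp only [rho, sw_ite]
  split_ifs <;> first | contradiction | omega | rfl | (congr 1; omega)

lemma rho2_sw (k : ℕ) (a : X) :
    rho (k+1) (rho (k+1) (sw k a)) = sw 0 (rho (k+1) (rho (k+1) a)) := by
  funext j
  simp only [rho, sw_ite]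
  split_ifs <;> first | contradiction | omega | rfl | (congr 1; omega) | simp_all

noncomputable def qi : R := LaurentPolynomial.T (-1)
lemma qq_qi : qq * qi = 1 := by
  rw [qq, qi, ← LaurentPolynomial.T_add]; simp

lemma qi_qq : qi * qq = 1 := by rw [mul_comm, qq_qi]

/-- `g_i` as a unit -/
noncomputable def gu (i : ℕ) : (Module.End R MM)ˣ where
  val := gl i
  inv := qi • gl i + (qi * (1 - qq)) • 1
  val_inv := by
    rw [mul_add, mul_smul_comm, gl_quad, mul_smul_comm, mul_one, smul_add, smul_smul, smul_smul,
      qi_qq, add_right_comm, ← add_smul, ← mul_add]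
    simp
  inv_val := by
    rw [add_mul, smul_mul_assoc, gl_quad, smul_mul_assoc, one_mul, smul_add, smul_smul, smul_smul,
      qi_qq, add_right_comm, ← add_smul, ← mul_add]
    simp

noncomputable def rl (m : ℕ) : Module.End R MM := Finsupp.lmapDomain R R (rho m)

noncomputable def ru (m : ℕ) : (Module.End R MM)ˣ where
  val := rl m
  inv := Finsupp.lmapDomain R R (rhoi m)
  val_inv := by
    rw [rl, Module.End.mul_eq_comp, ← Finsupp.lmapDomain_comp]
    have : rho m ∘ rhoi m = id := funext (rhop m).right_inv
    rw [this, Finsupp.lmapDomain_id]; rfl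
  inv_val := by
    rw [rl, Module.End.mul_eq_comp, ← Finsupp.lmapDomain_comp]
    have : rhoi m ∘ rho m = id := funext (rhop m).left_inv
    rw [this, Finsupp.lmapDomain_id]; rfl

lemma rl_single (m : ℕ) (a : X) (c : R) :
    rl m (Finsupp.single a c) = Finsupp.single (rho m a) c := by
  simp [rl]

lemma rl_gl (m i : ℕ) (h : i + 1 < m) : rl m * gl i = gl (i+1) * rl m := by
  ext1 a
  ext1
  simp only [LinearMap.comp_apply, Finsupp.lsingle_apply, Module.End.mul_apply, rl_single]
  have e1 : rho m a (i+1) = a i := by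
    simp only [rho]; split_ifs <;> first | contradiction | omega | rfl
  have e2 : rho m a (i+1+1) = a (i+1) := by
    simp only [rho]; split_ifs <;> first | contradiction | omega | rfl
  have e3 := rho_sw m i h a
  rcases lt_trichotomy (a i) (a (i+1)) with h | h | h
  · rw [gl_lt h, gl_lt (by omega), rl_single, e3]
  · rw [gl_eq h, gl_eq (by omega), map_smul, rl_single]
  · rw [gl_gt h, gl_gt (by omega), map_add, map_smul, map_smul, rl_single, rl_single, e3]

lemma rl2_gl (k : ℕ) : rl (k+1) * rl (k+1) * gl k = gl 0 * (rl (k+1) * rl (k+1)) := by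
  ext1 a
  ext1
  simp only [LinearMap.comp_apply, Finsupp.lsingle_apply, Module.End.mul_apply, rl_single]
  have e1 : rho (k+1) (rho (k+1) a) 0 = a k + (k+2) := by
    simp only [rho]; split_ifs <;> first | contradiction | omega | (push_cast; simp; ring)
  have e2 : rho (k+1) (rho (k+1) a) (0+1) = a (k+1) + (k+2) := by
    simp only [rho]; split_ifs <;> first | contradiction | omega | (push_cast; ring)
  have e3 := rho2_sw k a
  rcases lt_trichotomy (a k) (a (k+1)) with h | h | h
  · rw [gl_lt h, gl_lt (by omega), rl_single, rl_single, e3]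
  · rw [gl_eq h, gl_eq (by omega), map_smul, map_smul, rl_single, rl_single]
  · rw [gl_gt h, gl_gt (by omega)]
    simp only [map_add, map_smul, rl_single, e3]

/-- The representation of the braid group together with its specialization at `q = 1`. -/
noncomputable def rep (m : ℕ) : B m →* (Module.End R MM)ˣ × Equiv.Perm X :=
  homB (fun i => (gu i, swp i)) (ru m, rhop m) m
    (fun i j h => Prod.ext (Units.ext (gl_comm i j h)) (Equiv.ext (sw_comm i j h)))
    (fun i => Prod.ext (Units.ext (gl_braid i)) (Equiv.ext (sw_braid i)))
    (fun i h => Prod.ext (Units.ext (rl_gl m i h)) (Equiv.ext (rho_sw m i h)))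
    (fun k h => by
      subst h
      exact Prod.ext (Units.ext (rl2_gl k)) (Equiv.ext (rho2_sw k)))

lemma rep_σ (m : ℕ) (i : Fin m) : rep m (σ i) = (gu i, swp i) := homB_σ _ _ _ _ _ _ _ _

/-- evaluation at `q = 1` -/
noncomputable def ev : R →+* ℂ := LaurentPolynomial.eval₂ (RingHom.id ℂ) 1

lemma ev_q : ev qq = 1 := by
  rw [ev, qq, LaurentPolynomial.eval₂_T]; simp

noncomputable def evM : MM →+ (X →₀ ℂ) := Finsupp.mapRange.addMonoidHom ev.toAddMonoidHom

lemma evM_single (a : X) (c : R) : evM (Finsupp.single a c) = Finsupp.single a (ev c) := by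
  simp [evM]

lemma evM_smul (c : R) (v : MM) : evM (c • v) = ev c • evM v := by
  ext a; simp [evM]

/-- `U` specializes to the permutation `p` -/
def Good (x : (Module.End R MM)ˣ × Equiv.Perm X) : Prop :=
  ∀ v, evM ((x.1 : Module.End R MM) v) = Finsupp.mapDomain x.2 (evM v)

lemma Good.mul {x y} (hx : Good x) (hy : Good y) : Good (x * y) := by
  intro v
  rw [Prod.fst_mul, Units.val_mul, Module.End.mul_apply, hx, hy, ← Finsupp.mapDomain_comp]; rfl

lemma Good.one : Good 1 := by
  intro v
  exact (Finsupp.mapDomain_id).symm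

lemma Good.inv {x} (hx : Good x) : Good x⁻¹ := by
  intro v
  have := hx ((x⁻¹.1 : Module.End R MM) v)
  rw [← Module.End.mul_apply, Prod.fst_inv, Units.mul_inv] at this
  apply Finsupp.mapDomain_injective x.2.injective
  rw [Prod.fst_inv, ← this, ← Finsupp.mapDomain_comp]
  have h : (x.2 : X → X) ∘ (x⁻¹.2 : X → X) = id := by
    funext z; simp
  rw [h, Finsupp.mapDomain_id]; rfl

lemma good_of {x : (Module.End R MM)ˣ × Equiv.Perm X}
    (h : ∀ a, evM ((x.1 : Module.End R MM) (Finsupp.single a 1)) = Finsupp.single (x.2 a) 1) :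
    Good x := by
  intro v
  induction v using Finsupp.induction_linear with
  | zero => simp
  | add f g hf hg => simp only [map_add, hf, hg, Finsupp.mapDomain_add]
  | single a c =>
    have : Finsupp.single a c = c • (Finsupp.single a 1 : MM) := by simp
    rw [this, map_smul, evM_smul, h, evM_smul, evM_single, map_one, Finsupp.mapDomain_smul,
      Finsupp.mapDomain_single]

lemma good_g (i : ℕ) : Good (gu i, swp i) := by
  apply good_of
  intro a
  change evM (gl i _) = Finsupp.single (sw i a) 1
  rcases lt_trichotomy (a i) (a (i+1)) with h | h | h
  · rw [gl_lt h, evM_single, map_one]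
  · rw [gl_eq h, evM_smul, evM_single, map_one, ev_q, sw_eq i a h, one_smul]
  · rw [gl_gt h, map_add, evM_smul, evM_smul, evM_single, map_one, map_sub, ev_q]; simp

lemma good_r (m : ℕ) : Good (ru m, rhop m) := by
  apply good_of
  intro a
  change evM (rl m _) = Finsupp.single (rho m a) 1
  rw [rl_single, evM_single, map_one]

lemma good_E (k : ℕ) : Good (EE (fun i => (gu i, swp i)) k) := by
  induction k with
  | zero => exact Good.one
  | succ k ih => exact (good_g k).inv.mul ih

lemma good_rep (m : ℕ) (b : B m) : Good (rep m b) := by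
  let S : Subgroup (B m) :=
    { carrier := {b | Good (rep m b)}
      mul_mem' := fun ha hb => by
        simp only [Set.mem_setOf_eq, map_mul] at *; exact ha.mul hb
      one_mem' := by simp only [Set.mem_setOf_eq, map_one]; exact Good.one
      inv_mem' := fun ha => by simp only [Set.mem_setOf_eq, map_inv] at *; exact ha.inv }
  have : b ∈ S := by
    apply PresentedGroup.generated_by
    rintro (_ | i)
    · change Good (rep m τ)
      rw [rep, homB_τ]
      exact (good_r m).mul (good_E m)
    · change Good (rep m (σ i))
      rw [rep_σ]; exact good_g i
  exact this

/-- the permutation action at `q = 1` -/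
noncomputable def phi (m : ℕ) : B m →* Equiv.Perm X := (MonoidHom.snd _ _).comp (rep m)

lemma phi_σ (m : ℕ) (i : Fin m) (a : X) : phi m (σ i) a = sw i a := by
  simp only [phi, MonoidHom.comp_apply, rep_σ]; rfl

lemma phi_sig (m : ℕ) (i : ℕ) (h : i < m) (a : X) : phi m (sig (i+1)) a = sw i a := by
  rw [sig, dif_pos ⟨by omega, by simpa using h⟩, phi_σ]; rfl

lemma phi_E_aux {G H : Type*} [Group G] [Group H] (f : G →* H) (s : ℕ → G) (k : ℕ) :
    f (EE s k) = EE (fun i => f (s i)) k := by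
  induction k with
  | zero => simp [EE]
  | succ k ih => simp [EE, ih]

lemma EE_swp (k : ℕ) (a : X) (j : ℕ) : (EE swp k a) j =
    if j < k then a (j+1) else if j = k then a 0 else a j := by
  induction k generalizing j with
  | zero => simp [EE]; intro h; rw [h]
  | succ k ih =>
    have : EE swp (k+1) a = sw k (EE swp k a) := rfl
    rw [this, sw_ite]
    simp only [ih]
    split_ifs <;> first | contradiction | omega | rfl | (congr 1; omega)

/-- the looping element at index `j` adds `m+1` to coordinate `j` -/
lemma phi_tt (m j : ℕ) (h : j ≤ m) (a : X) :
    phi m (tt j) a = Function.update a j (a j + (m+1)) := by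
  induction j generalizing a with
  | zero =>
    have : phi m (tt 0) = rhop m * EE swp m := by
      change (MonoidHom.snd _ _) (rep m τ) = _
      rw [rep, homB_τ, map_mul, phi_E_aux]; rfl
    rw [this]
    change rho m (EE swp m a) = _
    funext i
    simp only [rho, EE_swp, Function.update_apply]
    split_ifs <;> first | contradiction | omega | rfl | (congr 1; omega) | simp_all
  | succ j ih =>
    rw [tt, map_mul, map_mul, Equiv.Perm.mul_apply, Equiv.Perm.mul_apply, phi_sig _ _ (by omega),
      phi_sig _ _ (by omega), ih (by omega)]
    funext i
    simp only [sw_ite, Function.update_apply]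
    split_ifs <;> first | contradiction | omega | rfl | (congr 1; omega) | simp_all

/-! ## Linear independence -/

noncomputable def repH (m : ℕ) : H m →ₐ[R] Module.End R MM :=
  RingQuot.liftAlgHom R ⟨MonoidAlgebra.lift R (Module.End R MM) (B m)
    ((Units.coeHom _).comp ((MonoidHom.fst _ _).comp (rep m))), by
    rintro _ _ ⟨i⟩
    simp only [map_mul, map_add, map_smul, map_one, MonoidAlgebra.lift_of, MonoidHom.comp_apply,
      rep_σ]
    exact gl_quad i⟩

lemma pih_eq (m : ℕ) (b : B m) :
    pih m b = RingQuot.mkAlgHom R (heckeRel m) (MonoidAlgebra.of R (B m) b) := by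
  have := RingQuot.mkAlgHom_coe R (heckeRel m)
  change RingQuot.mkRingHom (heckeRel m) (MonoidAlgebra.of R (B m) b) = _
  rw [← this]; rfl

lemma repH_pih (m : ℕ) (b : B m) : repH m (pih m b) = ((rep m b).1 : Module.End R MM) := by
  rw [pih_eq, repH, RingQuot.liftAlgHom_mkAlgHom_apply, MonoidAlgebra.lift_of]; rfl

lemma ev_dvd (c : R) (h : ev c = 0) : ∃ d, c = (qq - 1) * d := by
  obtain ⟨n, p, hp⟩ := LaurentPolynomial.exists_T_pow c
  have h1 : ev (Polynomial.toLaurent p) = 0 := by rw [hp, map_mul, h, zero_mul]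
  rw [ev, LaurentPolynomial.eval₂_toLaurent] at h1
  have h2 : p.IsRoot 1 := by
    simpa [Polynomial.eval₂_eq_eval_map] using h1
  obtain ⟨d, rfl⟩ := Polynomial.dvd_iff_isRoot.2 h2
  refine ⟨Polynomial.toLaurent d * LaurentPolynomial.T (-n), ?_⟩
  have h3 : c = c * LaurentPolynomial.T n * LaurentPolynomial.T (-n) := by
    rw [mul_assoc, ← LaurentPolynomial.T_add]; simp
  rw [h3, ← hp, map_mul, map_sub, mul_assoc]
  simp [qq]

lemma q1_not_unit : ¬ IsUnit (qq - 1 : R) := by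
  intro h
  have := h.map ev
  rw [map_sub, ev_q, map_one, sub_self] at this
  exact not_isUnit_zero this

lemma pow_dvd_zero (c : R) (h : ∀ n : ℕ, (qq - 1) ^ n ∣ c) : c = 0 := by
  have : IsNoetherianRing R :=
    IsLocalization.isNoetherianRing (Submonoid.powers (Polynomial.X : Polynomial ℂ)) R inferInstance
  by_contra hc
  obtain ⟨n, hn⟩ := FiniteMultiplicity.of_not_isUnit q1_not_unit hc
  exact hn (h _)

lemma q1_ne : (qq - 1 : R) ≠ 0 := by
  intro h0
  have : (1 : R) = 0 := pow_dvd_zero 1 (fun n => by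
    have h1 : (0:R) = qq - 1 := h0.symm
    exfalso
    have h2 : qq = 1 := sub_eq_zero.1 h0
    have h3 : (LaurentPolynomial.T 1 : R) = LaurentPolynomial.T 0 := by
      rw [LaurentPolynomial.T_zero]; exact h2
    have h4 := LaurentPolynomial.eval₂_T (RingHom.id ℂ) (Units.mk0 2 two_ne_zero) 1
    rw [h3, LaurentPolynomial.T_zero, map_one] at h4
    norm_num at h4)
  exact one_ne_zero this

lemma li_of_ev {ι : Type*} (v : ι → MM) (F : ι → X) (hF : Function.Injective F)
    (h : ∀ i, evM (v i) = Finsupp.single (F i) 1) : LinearIndependent R v := by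
  classical
  rw [linearIndependent_iff]
  choose f hf using ev_dvd
  let g : R → R := fun c => if h : ev c = 0 then (if c = 0 then 0 else f c h) else 0
  have hg0 : g 0 = 0 := by simp [g]
  have hg : ∀ c, ev c = 0 → c = (qq - 1) * g c := by
    intro c hc
    by_cases h0 : c = 0
    · rw [h0, hg0, mul_zero]
    · simp only [g, dif_pos hc, if_neg h0]; exact hf c hc
  have step : ∀ l : ι →₀ R, Finsupp.linearCombination R v l = 0 →
      ∃ l' : ι →₀ R, l = (qq - 1) • l' ∧ Finsupp.linearCombination R v l' = 0 := by
    intro l hl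
    have h1 : Finsupp.mapDomain F (Finsupp.mapRange ev (map_zero ev) l) = 0 := by
      rw [← map_zero evM, ← hl, Finsupp.linearCombination_apply, Finsupp.sum, map_sum]
      simp only [evM_smul, h]
      rw [Finsupp.mapDomain, Finsupp.sum_mapRange_index (by simp), Finsupp.sum]
      simp
    have h2 : ∀ i, ev (l i) = 0 := by
      intro i
      have h3 := Finsupp.mapDomain_injective hF (h1.trans Finsupp.mapDomain_zero.symm)
      simpa using DFunLike.congr_fun h3 i
    have h4 : l = (qq - 1) • Finsupp.mapRange g hg0 l := by
      ext1 i
      simpa using hg _ (h2 i)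
    refine ⟨_, h4, ?_⟩
    rw [h4, map_smul] at hl
    exact (smul_eq_zero.1 hl).resolve_left q1_ne
  intro l hl
  have key : ∀ n : ℕ, ∃ l' : ι →₀ R, l = (qq - 1) ^ n • l' ∧ Finsupp.linearCombination R v l' = 0 := by
    intro n
    induction n with
    | zero => exact ⟨l, by simp, hl⟩
    | succ n ih =>
      obtain ⟨l', h1, h2⟩ := ih
      obtain ⟨l'', h3, h4⟩ := step l' h2
      exact ⟨l'', by rw [h1, h3, smul_smul, pow_succ], h4⟩
  ext1 i
  apply pow_dvd_zero
  intro n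
  obtain ⟨l', h1, -⟩ := key n
  exact ⟨l' i, by rw [h1]; simp⟩

/-! ## Words -/

section words
variable {G : Type*} [Group G]

/-- products `y_0 y_1 ⋯ y_{K-1}` with `y_i = 1` or `y_i ∈ S i` -/
def PS (S : ℕ → Set G) : ℕ → Set G
  | 0 => {1}
  | (k+1) => {x | ∃ u ∈ PS S k, ∃ d, (d = 1 ∨ d ∈ S k) ∧ x = u * d}

lemma PS_iff (S : ℕ → Set G) (K : ℕ) (x : G) : x ∈ PS S K ↔
    ∃ (r : ℕ) (ind : Fin r → ℕ) (y : Fin r → G), StrictMono ind ∧ (∀ j, ind j < K) ∧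
      (∀ j, y j ∈ S (ind j)) ∧ x = (List.ofFn y).prod := by
  induction K generalizing x with
  | zero =>
    constructor
    · intro h
      exact ⟨0, Fin.elim0, Fin.elim0, fun i => i.elim0, fun i => i.elim0, fun i => i.elim0,
        by simpa [PS] using h⟩
    · rintro ⟨r, ind, y, -, h, -, rfl⟩
      have : r = 0 := by
        by_contra h0
        exact absurd (h ⟨0, by omega⟩) (by omega)
      subst this
      simp [PS]
  | succ K ih =>
    constructor
    · rintro ⟨u, hu, d, hd, rfl⟩
      obtain ⟨r, ind, y, h1, h2, h3, rfl⟩ := (ih u).1 hu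
      rcases hd with rfl | hd
      · exact ⟨r, ind, y, h1, fun j => (h2 j).trans (by omega), h3, by simp⟩
      · refine ⟨r+1, Fin.snoc (α := fun _ => ℕ) ind K, Fin.snoc (α := fun _ => G) y d, ?_, ?_, ?_, ?_⟩
        · intro i j hij
          induction j using Fin.lastCases with
          | last =>
            induction i using Fin.lastCases with
            | last => exact absurd hij (lt_irrefl _)
            | cast i => simpa using h2 i
          | cast j =>
            induction i using Fin.lastCases with
            | last => exact absurd hij (by simp [Fin.lt_def])
            | cast i => simpa using h1 (by simpa using hij)
        · intro j
          induction j using Fin.lastCases with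
          | last => simp
          | cast j => simpa using Nat.lt_succ_of_lt (h2 j)
        · intro j
          induction j using Fin.lastCases with
          | last => simpa using hd
          | cast j => simpa using h3 j
        · rw [List.ofFn_succ']
          simp
    · rintro ⟨r, ind, y, h1, h2, h3, rfl⟩
      rcases r with _ | r
      · exact ⟨1, (ih 1).2 ⟨0, Fin.elim0, Fin.elim0, fun i => i.elim0, fun i => i.elim0,
          fun i => i.elim0, by simp⟩, 1, Or.inl rfl, by simp⟩
      by_cases hl : ind (Fin.last r) = K
      · refine ⟨(List.ofFn (fun j : Fin r => y j.castSucc)).prod, (ih _).2 ⟨r, fun j => ind j.castSucc,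
          fun j => y j.castSucc, fun i j hij => h1 (by simpa using hij), fun j => ?_,
          fun j => h3 _, rfl⟩, y (Fin.last r), Or.inr (hl ▸ h3 _), ?_⟩
        · have := h1 (Fin.castSucc_lt_last j)
          change ind j.castSucc < K
          omega
        · rw [List.ofFn_succ']; simp
      · refine ⟨_, (ih _).2 ⟨r+1, ind, y, h1, fun j => ?_, h3, rfl⟩, 1, Or.inl rfl, by simp⟩
        have a1 := h1.monotone (Fin.le_last j)
        have a2 := h2 (Fin.last r)
        omega

end words

def tS (m : ℕ) (i : ℕ) : Set (B m) := {x | ∃ k : ℤ, k ≠ 0 ∧ x = tt i ^ k}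
def dS (m : ℕ) (i : ℕ) : Set (B m) := {x | ∃ k : ℕ, 1 ≤ i ∧ k ≤ i - 1 ∧ x = desc i k}

lemma jones_iff {m : ℕ} (w : B m) : JonesWord w ↔ w ∈ PS (dS m) (m+1) := by
  rw [PS_iff]
  constructor
  · rintro ⟨p, i, k, h1, h2, h3, rfl⟩
    exact ⟨p, i, _, h1, fun j => by have := h2 j; omega, fun j => ⟨k j, (h2 j).1, h3 j, rfl⟩, rfl⟩
  · rintro ⟨p, i, y, h1, h2, h3, rfl⟩
    choose k hk using h3
    refine ⟨p, i, k, h1, fun j => ⟨(hk j).1, by have := h2 j; omega⟩, fun j => (hk j).2.1, ?_⟩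
    congr 2
    funext j
    exact (hk j).2.2

lemma sigma_iff {m : ℕ} (x : H m) : x ∈ SigmaSet m ↔
    ∃ u ∈ PS (tS m) (m+1), ∃ w ∈ PS (dS m) (m+1), x = pih m (u * w) := by
  constructor
  · rintro ⟨r, ind, ke, w, h1, h2, h3, h4, rfl⟩
    refine ⟨_, (PS_iff _ _ _).2 ⟨r, ind, _, h1, fun j => by have := h2 j; omega,
      fun j => ⟨ke j, h3 j, rfl⟩, rfl⟩, w, (jones_iff w).1 h4, rfl⟩
  · rintro ⟨u, hu, w, hw, rfl⟩
    obtain ⟨r, ind, y, h1, h2, h3, rfl⟩ := (PS_iff _ _ _).1 hu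
    choose k hk using h3
    refine ⟨r, ind, k, w, h1, fun j => by have := h2 j; omega, fun j => (hk j).1,
      (jones_iff w).2 hw, ?_⟩
    congr 4
    funext j
    exact (hk j).2

lemma phi_tt_zpow (m j : ℕ) (h : j ≤ m) (k : ℤ) (a : X) :
    phi m (tt j ^ k) a = Function.update a j (a j + (m+1) * k) := by
  induction k using Int.induction_on generalizing a with
  | zero => simp
  | succ i ih =>
    rw [zpow_add_one, map_mul, Equiv.Perm.mul_apply, phi_tt m j h, ih]
    simp; ring_nf
  | pred i ih =>
    have : phi m (tt j)⁻¹ a = Function.update a j (a j - (m+1)) := by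
      rw [map_inv, Equiv.Perm.inv_eq_iff_eq, phi_tt m j h]; simp
    rw [zpow_sub_one, map_mul, Equiv.Perm.mul_apply, this, ih]
    simp; ring_nf

/-- ordered monomial in the looping elements -/
def mon (m : ℕ) (l : ℕ → ℤ) : ℕ → B m
  | 0 => 1
  | (k+1) => mon m l k * tt k ^ l k

lemma mon_congr (m : ℕ) (l l' : ℕ → ℤ) (K : ℕ) (h : ∀ j < K, l j = l' j) :
    mon m l K = mon m l' K := by
  induction K with
  | zero => rfl
  | succ K ih => rw [mon, mon, ih (fun j hj => h j (by omega)), h K (by omega)]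

lemma mon_of_PS (m K : ℕ) (u : B m) (hu : u ∈ PS (tS m) K) : ∃ l, u = mon m l K := by
  induction K generalizing u with
  | zero => exact ⟨0, hu⟩
  | succ K ih =>
    obtain ⟨v, hv, d, hd, rfl⟩ := hu
    obtain ⟨l, rfl⟩ := ih v hv
    obtain ⟨k, rfl⟩ : ∃ k : ℤ, d = tt K ^ k := by
      rcases hd with rfl | ⟨k, -, rfl⟩
      exacts [⟨0, by simp⟩, ⟨k, rfl⟩]
    refine ⟨Function.update l K k, ?_⟩
    rw [mon, mon_congr m l (Function.update l K k) K (fun j hj => by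
      rw [Function.update_of_ne (by omega)])]
    simp

lemma PS_mon (m K : ℕ) (l : ℕ → ℤ) : mon m l K ∈ PS (tS m) K := by
  induction K with
  | zero => rfl
  | succ K ih =>
    refine ⟨_, ih, _, ?_, rfl⟩
    by_cases h : l K = 0
    · left; simp [h]
    · exact Or.inr ⟨_, h, rfl⟩

lemma phi_mon (m K : ℕ) (hK : K ≤ m + 1) (l : ℕ → ℤ) (a : X) (j : ℕ) :
    phi m (mon m l K) a j = if j < K then a j + (m+1) * l j else a j := by
  induction K generalizing a with
  | zero => simp [mon]
  | succ K ih =>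
    rw [mon, map_mul, Equiv.Perm.mul_apply, phi_tt_zpow m K (by omega), ih (by omega)]
    simp only [Function.update_apply]
    split_ifs <;> first | omega | rfl | simp_all

lemma phi_desc (m i k : ℕ) (h1 : 1 ≤ i) (hi : i ≤ m) (hk : k ≤ i - 1) :
    ∃ π : Equiv.Perm ℕ, (∀ j, i < j → π j = j) ∧ π i = i - 1 - k ∧
      ∀ a : X, phi m (desc i k) a = a ∘ π := by
  have hs : ∀ j, 1 ≤ j → j ≤ m → ∀ a, phi m (sig j) a = a ∘ Equiv.swap (j-1) j := by
    intro j h1 h2 a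
    obtain ⟨j, rfl⟩ : ∃ k, j = k + 1 := ⟨j - 1, by omega⟩
    rw [phi_sig m j (by omega)]; rfl
  induction k with
  | zero =>
    refine ⟨Equiv.swap (i-1) i, fun j hj => Equiv.swap_apply_of_ne_of_ne (by omega) (by omega),
      by simp, hs i h1 hi⟩
  | succ k ih =>
    obtain ⟨π, p1, p2, p3⟩ := ih (by omega)
    refine ⟨Equiv.swap (i-(k+1)-1) (i-(k+1)) * π, fun j hj => ?_, ?_, fun a => ?_⟩
    · rw [Equiv.Perm.mul_apply, p1 j hj, Equiv.swap_apply_of_ne_of_ne (by omega) (by omega)]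
    · rw [Equiv.Perm.mul_apply, p2, show i - 1 - k = i - (k+1) by omega, Equiv.swap_apply_right]
      omega
    · rw [desc, map_mul, Equiv.Perm.mul_apply, p3, hs _ (by omega) (by omega)]; rfl

lemma phi_PS (m K : ℕ) (hK : K ≤ m + 1) (w : B m) (hw : w ∈ PS (dS m) K) :
    ∃ π : Equiv.Perm ℕ, (∀ j, K ≤ j → π j = j) ∧ ∀ a : X, phi m w a = a ∘ π := by
  induction K generalizing w with
  | zero =>
    have : w = 1 := hw
    exact ⟨1, fun _ _ => rfl, fun a => by rw [this, map_one]; rfl⟩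
  | succ K ih =>
    obtain ⟨u, hu, d, hd, rfl⟩ := hw
    obtain ⟨π, p1, p2⟩ := ih (by omega) u hu
    rcases hd with rfl | ⟨k, h1, h2, rfl⟩
    · exact ⟨π, fun j hj => p1 j (by omega), by simpa using p2⟩
    · obtain ⟨ψ, q1, q2, q3⟩ := phi_desc m K k h1 (by omega) h2
      refine ⟨ψ * π, fun j hj => ?_, fun a => ?_⟩
      · rw [Equiv.Perm.mul_apply, p1 j (by omega), q1 j (by omega)]
      · rw [map_mul, Equiv.Perm.mul_apply, p2, q3]; rfl

lemma jones_inj (m K : ℕ) (hK : K ≤ m + 1) (w w' : B m) (hw : w ∈ PS (dS m) K)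
    (hw' : w' ∈ PS (dS m) K) (a : X) (ha : Function.Injective a) (h : phi m w a = phi m w' a) :
    w = w' := by
  induction K generalizing w w' a with
  | zero => exact Eq.trans hw (Eq.symm hw')
  | succ K ih =>
    obtain ⟨u, hu, d, hd, rfl⟩ := hw
    obtain ⟨u', hu', d', hd', rfl⟩ := hw'
    obtain ⟨π, p1, p2⟩ := phi_PS m K (by omega) u hu
    obtain ⟨π', p1', p2'⟩ := phi_PS m K (by omega) u' hu'
    simp only [map_mul, Equiv.Perm.mul_apply] at h
    have hKK := congrFun h K
    rw [p2, p2', Function.comp_apply, Function.comp_apply, p1 K le_rfl, p1' K le_rfl] at hKK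
    have inj : Function.Injective (phi m d a) := by
      rcases hd with rfl | ⟨k, h1, h2, rfl⟩
      · simpa using ha
      · obtain ⟨ψ, q1, q2, q3⟩ := phi_desc m K k h1 (by omega) h2
        rw [q3]; exact ha.comp ψ.injective
    have hdd : d = d' := by
      rcases hd with rfl | ⟨k, h1, h2, rfl⟩ <;> rcases hd' with rfl | ⟨k', h1', h2', rfl⟩
      · rfl
      · obtain ⟨ψ, q1, q2, q3⟩ := phi_desc m K k' h1' (by omega) h2'
        rw [q3, Function.comp_apply, q2, map_one] at hKK
        have := ha hKK
        omega
      · obtain ⟨ψ, q1, q2, q3⟩ := phi_desc m K k h1 (by omega) h2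
        rw [q3, Function.comp_apply, q2, map_one] at hKK
        have := ha hKK
        omega
      · obtain ⟨ψ, q1, q2, q3⟩ := phi_desc m K k h1 (by omega) h2
        obtain ⟨ψ', q1', q2', q3'⟩ := phi_desc m K k' h1' (by omega) h2'
        rw [q3, q3', Function.comp_apply, Function.comp_apply, q2, q2'] at hKK
        have := ha hKK
        have : k = k' := by omega
        rw [this]
    subst hdd
    rw [ih (by omega) u u' hu hu' _ inj h]

lemma word_inj (m : ℕ) (u w u' w' : B m) (hu : u ∈ PS (tS m) (m+1)) (hu' : u' ∈ PS (tS m) (m+1))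
    (hw : w ∈ PS (dS m) (m+1)) (hw' : w' ∈ PS (dS m) (m+1))
    (h : phi m (u * w) (fun j => (j : ℤ)) = phi m (u' * w') (fun j => (j : ℤ))) :
    u * w = u' * w' := by
  obtain ⟨l, rfl⟩ := mon_of_PS m _ u hu
  obtain ⟨l', rfl⟩ := mon_of_PS m _ u' hu'
  obtain ⟨π, p1, p2⟩ := phi_PS m _ le_rfl w hw
  obtain ⟨π', p1', p2'⟩ := phi_PS m _ le_rfl w' hw'
  have bd : ∀ π : Equiv.Perm ℕ, (∀ j, m + 1 ≤ j → π j = j) → ∀ j, j < m + 1 → π j < m + 1 := by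
    intro π hπ j hj
    by_contra hh
    have := π.injective (hπ (π j) (by omega))
    omega
  simp only [map_mul, Equiv.Perm.mul_apply] at h
  have hj : ∀ j < m + 1, (π j : ℤ) = π' j ∧ l j = l' j := by
    intro j hj
    have e := congrFun h j
    rw [phi_mon m _ le_rfl, phi_mon m _ le_rfl, if_pos hj, if_pos hj, p2, p2'] at e
    simp only [Function.comp_apply] at e
    have b1 := bd π p1 j hj
    have b2 := bd π' p1' j hj
    have e' : (m + 1 : ℤ) * (l j - l' j) = π' j - π j := by linarith
    have b3 : l j - l' j = 0 := by
      by_contra hne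
      rcases lt_or_gt_of_ne hne with hlt | hgt
      · have : (m + 1 : ℤ) * (l j - l' j) ≤ (m+1 : ℤ) * (-1) :=
          mul_le_mul_of_nonneg_left (by omega) (by positivity)
        omega
      · have : (m + 1 : ℤ) * 1 ≤ (m+1 : ℤ) * (l j - l' j) :=
          mul_le_mul_of_nonneg_left (by omega) (by positivity)
        omega
    rw [b3, mul_zero] at e'
    exact ⟨by omega, by omega⟩
  have hww : w = w' := by
    apply jones_inj m _ le_rfl w w' hw hw' (fun j => (j : ℤ)) Nat.cast_injective
    rw [p2, p2']
    funext j
    by_cases hjm : j < m + 1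
    · exact (hj j hjm).1
    · simp only [Function.comp_apply]
      rw [p1 j (by omega), p1' j (by omega)]
  rw [hww, mon_congr m l l' _ (fun j h => (hj j h).2)]

theorem sigma_li (m : ℕ) : LinearIndependent R (fun x : SigmaSet m => (x : H m)) := by
  have hx : ∀ x : SigmaSet m, ∃ b : B m, (∃ u ∈ PS (tS m) (m+1), ∃ w ∈ PS (dS m) (m+1), b = u * w) ∧
      (x : H m) = pih m b := by
    rintro ⟨x, hx⟩
    obtain ⟨u, hu, w, hw, rfl⟩ := (sigma_iff x).1 hx
    exact ⟨u * w, ⟨u, hu, w, hw, rfl⟩, rfl⟩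
  choose b hb hxb using hx
  let a0 : X := fun j => (j : ℤ)
  let f : H m →ₗ[R] MM :=
    (LinearMap.applyₗ (Finsupp.single a0 1 : MM)).comp (repH m).toLinearMap
  apply LinearIndependent.of_comp f
  apply li_of_ev _ (fun x => phi m (b x) a0)
  · intro x y hxy
    obtain ⟨u, hu, w, hw, h1⟩ := hb x
    obtain ⟨u', hu', w', hw', h2⟩ := hb y
    have := word_inj m u w u' w' hu hu' hw hw' (by rw [← h1, ← h2]; exact hxy)
    apply Subtype.ext
    rw [hxb, hxb, h1, h2, this]
  · intro x
    change evM (repH m (x : H m) (Finsupp.single a0 1)) = _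
    rw [hxb, repH_pih, good_rep m (b x), evM_single, map_one, Finsupp.mapDomain_single]
    rfl

/-! ## Spanning -/

lemma sig_out {m i : ℕ} (h : ¬ (1 ≤ i ∧ i ≤ m)) : (sig i : B m) = 1 := by
  rw [sig, dif_neg]; omega

lemma sig_in {m i : ℕ} (h : i < m) : (sig (i+1) : B m) = σ ⟨i, h⟩ := by
  rw [sig, dif_pos ⟨by omega, by simpa using h⟩]; rfl

lemma σ_braid {m : ℕ} (i j : Fin m) (h : (i : ℕ) + 1 = j) :
    (σ i * σ j * σ i : B m) = σ j * σ i * σ j := by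
  rw [← mul_inv_eq_one]
  exact PresentedGroup.one_of_mem (rels := rels m) (Or.inr (Or.inr (Or.inl ⟨i, j, h, rfl⟩)))

lemma σ_comm {m : ℕ} (i j : Fin m) (h : (i : ℕ) + 1 < j) : (σ i * σ j : B m) = σ j * σ i := by
  rw [← mul_inv_eq_one]
  exact PresentedGroup.one_of_mem (rels := rels m) (Or.inr (Or.inr (Or.inr ⟨i, j, h, rfl⟩)))

lemma τ_comm {m : ℕ} (i : Fin m) (h : 1 ≤ (i : ℕ)) : (τ * σ i : B m) = σ i * τ := by
  rw [← mul_inv_eq_one]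
  exact PresentedGroup.one_of_mem (rels := rels m) (Or.inr (Or.inl ⟨i, h, rfl⟩))

lemma τ_B {m : ℕ} (h : 0 < m) : ((σ ⟨0, h⟩ * τ) ^ 2 : B m) = (τ * σ ⟨0, h⟩) ^ 2 := by
  rw [← mul_inv_eq_one]
  exact PresentedGroup.one_of_mem (rels := rels m) (Or.inl ⟨h, rfl⟩)

lemma sig_comm {m : ℕ} (i j : ℕ) (h : i + 1 < j) : Commute (sig i : B m) (sig j) := by
  by_cases h1 : 1 ≤ i ∧ i ≤ m
  · by_cases h2 : 1 ≤ j ∧ j ≤ m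
    · obtain ⟨i, rfl⟩ : ∃ k, i = k + 1 := ⟨i - 1, by omega⟩
      obtain ⟨j, rfl⟩ : ∃ k, j = k + 1 := ⟨j - 1, by omega⟩
      rw [sig_in (by omega), sig_in (by omega)]
      exact σ_comm _ _ (by simpa using h)
    · rw [sig_out h2]; exact Commute.one_right _
  · rw [sig_out h1]; exact Commute.one_left _

lemma sig_braid {m : ℕ} (i : ℕ) (h1 : 1 ≤ i) (h : i + 1 ≤ m) :
    (sig i * sig (i+1) * sig i : B m) = sig (i+1) * sig i * sig (i+1) := by
  obtain ⟨i, rfl⟩ : ∃ k, i = k + 1 := ⟨i - 1, by omega⟩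
  rw [sig_in (by omega), sig_in (by omega)]
  exact σ_braid _ _ rfl

lemma sig_tt_hi {m : ℕ} (i j : ℕ) (h : j + 2 ≤ i) : Commute (sig i : B m) (tt j) := by
  by_cases h1 : i ≤ m
  swap
  · rw [sig_out (by omega)]; exact Commute.one_left _
  induction j with
  | zero =>
    obtain ⟨i, rfl⟩ : ∃ k, i = k + 1 := ⟨i - 1, by omega⟩
    rw [sig_in (by omega)]
    exact (τ_comm _ (by simp; omega)).symm
  | succ j ih =>
    have c := (sig_comm (m := m) (j+1) i (by omega)).symm
    exact (c.mul_right (ih (by omega))).mul_right c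

lemma sig_tt_lo {m : ℕ} (i j : ℕ) (hi : 1 ≤ i) (h : i < j) (hj : j ≤ m) :
    Commute (sig i : B m) (tt j) := by
  induction j, h using Nat.le_induction with
  | base =>
    obtain ⟨k, rfl⟩ : ∃ k, i = k + 1 := ⟨i - 1, by omega⟩
    have hb := sig_braid (m := m) (k+1) (by omega) hj
    have hc := (sig_tt_hi (m := m) (k+1+1) k (by omega)).eq
    change sig (k+1) * (sig (k+1+1) * (sig (k+1) * tt k * sig (k+1)) * sig (k+1+1)) =
      sig (k+1+1) * (sig (k+1) * tt k * sig (k+1)) * sig (k+1+1) * sig (k+1)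
    generalize sig (k+1) = x at *
    generalize sig (k+1+1) = y at *
    generalize tt k = t at *
    calc x * (y * (x * t * x) * y) = (x * y * x) * t * x * y := by simp only [mul_assoc]
      _ = y * x * (y * t) * x * y := by rw [hb]; simp only [mul_assoc]
      _ = y * x * t * (y * x * y) := by rw [hc]; simp only [mul_assoc]
      _ = _ := by rw [← hb]; simp only [mul_assoc]
  | succ j h ih =>
    have c := sig_comm (m := m) i (j+1) (by omega)
    exact (c.mul_right (ih (by omega))).mul_right c

lemma tt_comm_lt {m : ℕ} (i j : ℕ) (h : i < j) (hj : j ≤ m) : Commute (tt i : B m) (tt j) := by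
  induction i with
  | zero =>
    induction j, h using Nat.le_induction with
    | base =>
      change τ * (sig (0+1) * τ * sig (0+1)) = sig (0+1) * τ * sig (0+1) * τ
      rw [sig_in (by omega)]
      have := τ_B (m := m) (by omega)
      simp only [pow_two, mul_assoc] at this ⊢
      exact this.symm
    | succ j h ih =>
      have c := (sig_tt_hi (m := m) (j+1) 0 (by omega)).symm
      exact (c.mul_right (ih (by omega))).mul_right c
  | succ i ih =>
    have c := sig_tt_lo (m := m) (i+1) j (by omega) h hj
    exact (c.mul_left (ih (by omega))).mul_left c

lemma tt_comm {m : ℕ} (i j : ℕ) (hi : i ≤ m) (hj : j ≤ m) : Commute (tt i : B m) (tt j) := by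
  rcases lt_trichotomy i j with h | rfl | h
  · exact tt_comm_lt i j h hj
  · exact Commute.refl _
  · exact (tt_comm_lt j i h hi).symm

lemma mon_comm (m K j : ℕ) (hK : K ≤ m + 1) (hj : j ≤ m) (l : ℕ → ℤ) :
    Commute (mon m l K) (tt j) := by
  induction K with
  | zero => exact Commute.one_left _
  | succ K ih => exact (ih (by omega)).mul_left ((tt_comm K j (by omega) hj).zpow_left _)

lemma mon_add (m K : ℕ) (hK : K ≤ m + 1) (l l' : ℕ → ℤ) :
    mon m l K * mon m l' K = mon m (l + l') K := by
  induction K with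
  | zero => simp [mon]
  | succ K ih =>
    simp only [mon]
    rw [← ih (by omega), mul_assoc, ← mul_assoc (tt K ^ l K),
      ((mon_comm m K K (by omega) (by omega) l').zpow_right (l K)).eq.symm, mul_assoc (mon m l' K),
      ← zpow_add, ← mul_assoc]
    rfl

lemma mon_single (m K j : ℕ) (k : ℤ) :
    mon m (Pi.single j k) K = if j < K then tt j ^ k else 1 := by
  induction K with
  | zero => simp [mon]
  | succ K ih =>
    rw [mon, ih]
    rcases lt_trichotomy j K with h | rfl | h
    · rw [if_pos h, if_pos (by omega), Pi.single_eq_of_ne (by omega)]; simp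
    · simp
    · rw [if_neg (by omega), if_neg (by omega), Pi.single_eq_of_ne (by omega)]; simp

/-- the torus subalgebra, as a span of monomials -/
noncomputable def Ator (m : ℕ) : Subalgebra R (H m) :=
  Algebra.adjoin R {x | ∃ j ≤ m, ∃ k : ℤ, x = pih m (tt j ^ k)}

lemma Ator_le (m : ℕ) : Subalgebra.toSubmodule (Ator m) ≤
    Submodule.span R ((pih m) '' (PS (tS m) (m+1))) := by
  rw [Ator, Algebra.adjoin_eq_span]
  apply Submodule.span_mono
  let S : Submonoid (H m) :=
    { carrier := pih m '' (PS (tS m) (m+1))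
      one_mem' := by
        refine ⟨mon m 0 (m+1), PS_mon _ _ _, ?_⟩
        have h1 : ∀ K, mon m 0 K = 1 := by
          intro K
          induction K with
          | zero => rfl
          | succ K ih => simp [mon, ih]
        rw [h1, map_one]
      mul_mem' := by
        rintro _ _ ⟨u, hu, rfl⟩ ⟨v, hv, rfl⟩
        obtain ⟨l, rfl⟩ := mon_of_PS _ _ _ hu
        obtain ⟨l', rfl⟩ := mon_of_PS _ _ _ hv
        rw [← map_mul, mon_add m _ le_rfl]
        exact ⟨_, PS_mon _ _ _, rfl⟩ }
  change Submonoid.closure _ ≤ S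
  rw [Submonoid.closure_le]
  rintro _ ⟨j, hj, k, rfl⟩
  refine ⟨mon m (Pi.single j k) (m+1), PS_mon _ _ _, ?_⟩
  rw [mon_single, if_pos (by omega)]

lemma pih_quad (m : ℕ) (i : Fin m) :
    pih m (σ i) * pih m (σ i) = (qq - 1) • pih m (σ i) + qq • 1 := by
  have := RingQuot.mkAlgHom_rel R (heckeRel.quad i)
  rw [map_mul, map_add, map_smul, map_smul, map_one] at this
  rw [pih_eq]; exact this

lemma sig_quad (m i : ℕ) (h1 : 1 ≤ i) (h : i ≤ m) :
    pih m (sig i) * pih m (sig i) = (qq - 1) • pih m (sig i) + qq • 1 := by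
  obtain ⟨i, rfl⟩ : ∃ k, i = k + 1 := ⟨i - 1, by omega⟩
  rw [sig_in (by omega)]; exact pih_quad _ _

lemma sig_mem (m i : ℕ) : pih m (sig i) ∈ HA m := by
  by_cases h : 1 ≤ i ∧ i ≤ m
  · obtain ⟨i, rfl⟩ : ∃ k, i = k + 1 := ⟨i - 1, by omega⟩
    rw [sig_in (by omega)]
    exact Algebra.subset_adjoin ⟨_, rfl⟩
  · rw [sig_out h, map_one]; exact one_mem _

lemma sig_inv (m i : ℕ) (h1 : 1 ≤ i) (h : i ≤ m) :
    pih m (sig i)⁻¹ = qi • pih m (sig i) + (qi * (1 - qq)) • 1 := by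
  have h2 : pih m (sig i) * (qi • pih m (sig i) + (qi * (1 - qq)) • 1) = 1 := by
    rw [mul_add, mul_smul_comm, sig_quad m i h1 h, mul_smul_comm, mul_one, smul_add, smul_smul,
      smul_smul, qi_qq, add_right_comm, ← add_smul, ← mul_add]
    simp
  calc pih m (sig i)⁻¹ = pih m (sig i)⁻¹ * (pih m (sig i) *
        (qi • pih m (sig i) + (qi * (1 - qq)) • 1)) := by rw [h2, mul_one]
    _ = _ := by rw [← mul_assoc, ← map_mul, inv_mul_cancel, map_one, one_mul]

/-- those `a` in the torus which can be moved past `g_i` -/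
def mv (m i : ℕ) (a : H m) : Prop :=
  ∃ b ∈ Ator m, ∃ c ∈ Ator m, pih m (sig i) * a = b + c * pih m (sig i)

lemma mv_pair (m i : ℕ) (h1 : 1 ≤ i) (h : i ≤ m) (x y : B m) (hx : pih m x ∈ Ator m)
    (hy : pih m y ∈ Ator m) (hxy : sig i * x * sig i = y) :
    mv m i (pih m x) ∧ mv m i (pih m y) := by
  constructor
  · refine ⟨(qi * (1 - qq)) • pih m y, Subalgebra.smul_mem _ hy _, qi • pih m y,
      Subalgebra.smul_mem _ hy _, ?_⟩
    have : sig i * x = y * (sig i)⁻¹ := by rw [← hxy]; simp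
    rw [← map_mul, this, map_mul, sig_inv m i h1 h, mul_add, mul_smul_comm, mul_smul_comm, mul_one,
      smul_mul_assoc, add_comm]
  · refine ⟨(qq - 1) • pih m y, Subalgebra.smul_mem _ hy _, qq • pih m x,
      Subalgebra.smul_mem _ hx _, ?_⟩
    rw [← hxy, map_mul, map_mul, ← mul_assoc, ← mul_assoc, sig_quad m i h1 h]
    simp only [add_mul, smul_mul_assoc, one_mul]

lemma mv_comm (m i : ℕ) (x : B m) (hx : pih m x ∈ Ator m) (h : Commute (sig i) x) :
    mv m i (pih m x) :=
  ⟨0, zero_mem _, pih m x, hx, by rw [← map_mul, h.eq, map_mul, zero_add]⟩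

lemma tt_zpow_mem (m j : ℕ) (hj : j ≤ m) (k : ℤ) : pih m (tt j ^ k) ∈ Ator m :=
  Algebra.subset_adjoin ⟨j, hj, k, rfl⟩

lemma mv_mul (m i : ℕ) (a b : H m) (ha : mv m i a) (hb' : b ∈ Ator m) (hb : mv m i b) :
    mv m i (a * b) := by
  obtain ⟨b1, h1, c1, k1, e1⟩ := ha
  obtain ⟨b2, h2, c2, k2, e2⟩ := hb
  refine ⟨b1 * b + c1 * b2, add_mem (mul_mem h1 hb') (mul_mem k1 h2), c1 * c2, mul_mem k1 k2, ?_⟩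
  rw [← mul_assoc, e1, add_mul, mul_assoc c1, e2, mul_add, add_assoc, mul_assoc c1 c2]

lemma mv_one (m i : ℕ) : mv m i 1 := ⟨0, zero_mem _, 1, one_mem _, by simp⟩

lemma mv_t (m i j : ℕ) (h1 : 1 ≤ i) (h : i ≤ m) (hj : j ≤ m) :
    mv m i (pih m (tt j)) ∧ mv m i (pih m (tt j)⁻¹) := by
  have hm : ∀ j ≤ m, pih m (tt j) ∈ Ator m := fun j hj => by simpa using tt_zpow_mem m j hj 1
  have hm' : ∀ j ≤ m, pih m (tt j)⁻¹ ∈ Ator m := fun j hj => by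
    have := tt_zpow_mem m j hj (-1)
    rwa [zpow_neg_one] at this
  obtain ⟨k, rfl⟩ : ∃ k, i = k + 1 := ⟨i - 1, by omega⟩
  have p1 := mv_pair m (k+1) h1 h (tt k) (tt (k+1)) (hm _ (by omega)) (hm _ h) rfl
  have p2 := mv_pair m (k+1) h1 h (tt (k+1))⁻¹ (tt k)⁻¹ (hm' _ h) (hm' _ (by omega)) (by
    rw [tt]; group)
  rcases Nat.lt_or_ge j k with h2 | h2
  · have c := sig_tt_hi (m := m) (k+1) j (by omega)
    exact ⟨mv_comm m _ _ (hm j hj) c, mv_comm m _ _ (hm' j hj) c.inv_right⟩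
  rcases Nat.lt_or_ge (k+1) j with h3 | h3
  · have c := sig_tt_lo (m := m) (k+1) j (by omega) h3 hj
    exact ⟨mv_comm m _ _ (hm j hj) c, mv_comm m _ _ (hm' j hj) c.inv_right⟩
  have : j = k ∨ j = k + 1 := by omega
  rcases this with rfl | rfl
  · exact ⟨p1.1, p2.2⟩
  · exact ⟨p1.2, p2.1⟩

lemma mv_zpow (m i j : ℕ) (h1 : 1 ≤ i) (h : i ≤ m) (hj : j ≤ m) (k : ℤ) :
    mv m i (pih m (tt j ^ k)) := by
  obtain ⟨p, p'⟩ := mv_t m i j h1 h hj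
  have b := tt_zpow_mem m j hj 1
  have b' := tt_zpow_mem m j hj (-1)
  rw [zpow_one] at b
  rw [zpow_neg_one] at b'
  induction k using Int.induction_on with
  | zero => rw [zpow_zero, map_one]; exact mv_one m i
  | succ k ih => rw [zpow_add_one, map_mul]; exact mv_mul m i _ _ ih b p
  | pred k ih => rw [zpow_sub_one, map_mul]; exact mv_mul m i _ _ ih b' p'

lemma mv_all (m i : ℕ) (h1 : 1 ≤ i) (h : i ≤ m) (a : H m) (ha : a ∈ Ator m) : mv m i a := by
  induction ha using Algebra.adjoin_induction with
  | mem x hx =>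
    obtain ⟨j, hj, k, rfl⟩ := hx
    exact mv_zpow m i j h1 h hj k
  | algebraMap r =>
    refine ⟨0, zero_mem _, algebraMap R (H m) r, Subalgebra.algebraMap_mem _ _, ?_⟩
    rw [zero_add]; exact (Algebra.commutes r _).symm
  | add x y hx hy ihx ihy =>
    obtain ⟨b1, h1, c1, k1, e1⟩ := ihx
    obtain ⟨b2, h2, c2, k2, e2⟩ := ihy
    refine ⟨b1 + b2, add_mem h1 h2, c1 + c2, add_mem k1 k2, ?_⟩
    rw [mul_add, e1, e2, add_mul]; abel
  | mul x y hx hy ihx ihy => exact mv_mul m i x y ihx hy ihy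

/-- Ator * HA -/
noncomputable def WW (m : ℕ) : Submodule R (H m) :=
  Subalgebra.toSubmodule (Ator m) * Subalgebra.toSubmodule (HA m)

lemma WW_A (m : ℕ) (a x : H m) (ha : a ∈ Ator m) (hx : x ∈ WW m) : a * x ∈ WW m := by
  induction hx using Submodule.mul_induction_on' with
  | mem_mul_mem b hb c hc =>
    rw [← mul_assoc]
    exact Submodule.mul_mem_mul (mul_mem (S := Subalgebra R (H m)) ha hb) hc
  | add x _ y _ hx hy => rw [mul_add]; exact add_mem hx hy

lemma WW_G (m i : ℕ) (x : H m) (hx : x ∈ WW m) : pih m (sig i) * x ∈ WW m := by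
  by_cases hi : 1 ≤ i ∧ i ≤ m
  swap
  · rw [sig_out hi, map_one, one_mul]; exact hx
  induction hx using Submodule.mul_induction_on' with
  | mem_mul_mem b hb c hc =>
    obtain ⟨b1, h1, c1, k1, e1⟩ := mv_all m i hi.1 hi.2 b hb
    rw [← mul_assoc, e1, add_mul, mul_assoc]
    exact add_mem (Submodule.mul_mem_mul h1 hc)
      (Submodule.mul_mem_mul k1 (mul_mem (S := Subalgebra R (H m)) (sig_mem m i) hc))
  | add x _ y _ hx hy => rw [mul_add]; exact add_mem hx hy

lemma WW_b (m : ℕ) (b : B m) : ∀ x ∈ WW m, pih m b * x ∈ WW m ∧ pih m b⁻¹ * x ∈ WW m := by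
  let S : Subgroup (B m) :=
    { carrier := {b | ∀ x ∈ WW m, pih m b * x ∈ WW m ∧ pih m b⁻¹ * x ∈ WW m}
      one_mem' := fun x hx => by simpa using hx
      mul_mem' := fun {a b} ha hb x hx => by
        rw [mul_inv_rev, map_mul, map_mul, mul_assoc, mul_assoc]
        exact ⟨(ha _ (hb x hx).1).1, (hb _ (ha x hx).2).2⟩
      inv_mem' := fun {a} ha x hx => by
        rw [inv_inv]; exact (ha x hx).symm }
  change b ∈ S
  apply PresentedGroup.generated_by
  rintro (_ | i)
  · intro x hx
    have h1 := tt_zpow_mem m 0 (by omega) 1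
    have h2 := tt_zpow_mem m 0 (by omega) (-1)
    rw [zpow_one] at h1
    rw [zpow_neg_one] at h2
    exact ⟨WW_A m _ x h1 hx, WW_A m _ x h2 hx⟩
  · intro x hx
    change pih m (σ i) * x ∈ WW m ∧ pih m (σ i)⁻¹ * x ∈ WW m
    have e : σ i = (sig (i+1) : B m) := (sig_in i.2).symm
    rw [e, sig_inv m _ (by omega) i.2, add_mul, smul_mul_assoc, smul_mul_assoc, one_mul]
    have h1 := WW_G m (i+1) x hx
    exact ⟨h1, add_mem (Submodule.smul_mem _ _ h1) (Submodule.smul_mem _ _ hx)⟩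

lemma WW_top (m : ℕ) : WW m = ⊤ := by
  rw [eq_top_iff]
  rintro x -
  obtain ⟨y, rfl⟩ := RingQuot.mkAlgHom_surjective R (heckeRel m) x
  have h1 : (1 : H m) ∈ WW m := by
    rw [← mul_one (1 : H m)]
    exact Submodule.mul_mem_mul (one_mem (Ator m)) (one_mem (HA m))
  induction y using MonoidAlgebra.induction_on with
  | of b =>
    rw [← pih_eq]
    simpa using (WW_b m b 1 h1).1
  | add f g hf hg => rw [map_add]; exact add_mem hf hg
  | smul r f hf => rw [map_smul]; exact Submodule.smul_mem _ _ hf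

/-- span of Jones words on the first strands -/
noncomputable def JJ (m K : ℕ) : Submodule R (H m) := Submodule.span R (pih m '' PS (dS m) K)

lemma PS_mono {G : Type*} [Group G] (S : ℕ → Set G) (K : ℕ) : PS S K ⊆ PS S (K+1) :=
  fun x hx => ⟨x, hx, 1, Or.inl rfl, by simp⟩

lemma JJ_mono (m K : ℕ) : JJ m K ≤ JJ m (K+1) :=
  Submodule.span_mono (Set.image_mono (PS_mono _ _))

lemma JJ_desc (m K l : ℕ) (h1 : 1 ≤ K) (hl : l ≤ K - 1) (x : H m) (hx : x ∈ JJ m K) :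
    x * pih m (desc K l) ∈ JJ m (K+1) := by
  induction hx using Submodule.span_induction with
  | mem x hx =>
    obtain ⟨u, hu, rfl⟩ := hx
    rw [← map_mul]
    exact Submodule.subset_span ⟨_, ⟨u, hu, _, Or.inr ⟨l, h1, hl, rfl⟩, rfl⟩, rfl⟩
  | zero => rw [zero_mul]; exact zero_mem _
  | add x y _ _ hx hy => rw [add_mul]; exact add_mem hx hy
  | smul r x _ hx => rw [smul_mul_assoc]; exact Submodule.smul_mem _ _ hx

/-- `σ_i` commutes with descending products on higher strands -/
lemma desc_comm (m K l i : ℕ) (h : i + 1 < K - l) : Commute (desc K l : B m) (sig i) := by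
  induction l with
  | zero => exact (sig_comm i K (by omega)).symm
  | succ l ih => exact (ih (by omega)).mul_left (sig_comm i _ (by omega)).symm

lemma desc_shift (m K l i : ℕ) (hK : K ≤ m) (hl : l ≤ K - 1) (h1 : K - l < i) (h2 : i ≤ K) :
    (desc K l * sig i : B m) = sig (i - 1) * desc K l := by
  induction l with
  | zero => omega
  | succ l ih =>
    rw [desc]
    rcases Nat.lt_or_ge (K - l) i with h3 | h3
    · rw [mul_assoc, (sig_comm (m := m) (K - (l+1)) i (by omega)).eq, ← mul_assoc,
        ih (by omega) h3, mul_assoc]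
    · have hi : i = K - (l+1) + 1 := by omega
      have hb := sig_braid (m := m) (K - (l+1)) (by omega) (by omega)
      rw [show i - 1 = K - (l+1) by omega]
      rw [← hi] at hb
      rcases l with _ | l
      · have : K = i := by omega
        rw [desc]
        rw [show (sig K : B m) = sig i by rw [this]]
        rw [← hb, mul_assoc]
      · have hd : (desc K (l+1) : B m) = desc K l * sig i := by
          rw [desc]; congr 2; omega
        have hc := desc_comm m K l (K - (l+1+1)) (by omega)
        rw [hd, mul_assoc, mul_assoc, ← mul_assoc (sig i), ← hb]
        simp only [← mul_assoc]
        rw [hc.eq]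

lemma JJ_right (m K : ℕ) (hK : K ≤ m + 1) (i : ℕ) (h1 : 1 ≤ i) (hi : i < K) (x : H m)
    (hx : x ∈ JJ m K) : x * pih m (sig i) ∈ JJ m K := by
  induction K generalizing i x with
  | zero => omega
  | succ K ih =>
    induction hx using Submodule.span_induction with
    | zero => rw [zero_mul]; exact zero_mem _
    | add x y _ _ hx hy => rw [add_mul]; exact add_mem hx hy
    | smul r x _ hx => rw [smul_mul_assoc]; exact Submodule.smul_mem _ _ hx
    | mem x hx =>
      obtain ⟨_, ⟨u, hu, d, hd, rfl⟩, rfl⟩ := hx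
      have hu' : pih m u ∈ JJ m K := Submodule.subset_span ⟨u, hu, rfl⟩
      rcases hd with rfl | ⟨l, g1, g2, rfl⟩
      · rw [mul_one]
        rcases Nat.lt_or_ge i K with h3 | h3
        · exact JJ_mono m K (ih (by omega) i h1 h3 _ hu')
        · have : i = K := by omega
          subst this
          exact JJ_desc m i 0 h1 (by omega) _ hu'
      · rcases Nat.lt_or_ge (K - l) i with h3 | h3
        · rw [← map_mul, mul_assoc, desc_shift m K l i (by omega) g2 h3 (by omega), ← mul_assoc,
            map_mul, map_mul]
          exact JJ_desc m K l g1 g2 _ (ih (by omega) (i-1) (by omega) (by omega) _ hu')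
        rcases Nat.lt_or_ge (i + 1) (K - l) with h4 | h4
        · rw [← map_mul, mul_assoc, (desc_comm m K l i h4).eq, ← mul_assoc, map_mul, map_mul]
          exact JJ_desc m K l g1 g2 _ (ih (by omega) i h1 (by omega) _ hu')
        have : i = K - l ∨ i = K - (l+1) := by omega
        rcases this with h5 | h5
        · have hd : ∃ e : H m, pih m (desc K l) = e * pih m (sig i) ∧ pih m u * e ∈ JJ m (K+1) := by
            rcases l with _ | l
            · exact ⟨1, by rw [desc, one_mul, h5, Nat.sub_zero], by
                rw [mul_one]; exact JJ_mono m K hu'⟩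
            · exact ⟨pih m (desc K l), by rw [desc, map_mul, h5],
                JJ_desc m K l g1 (by omega) _ hu'⟩
          obtain ⟨e, e1, e2⟩ := hd
          have e3 : pih m u * pih m (desc K l) ∈ JJ m (K+1) := JJ_desc m K l g1 g2 _ hu'
          rw [map_mul, e1, mul_assoc, mul_assoc, sig_quad m i h1 (by omega)]
          rw [mul_add, mul_smul_comm, mul_smul_comm, mul_one, ← e1, mul_add, mul_smul_comm,
            mul_smul_comm]
          exact add_mem (Submodule.smul_mem _ _ e3) (Submodule.smul_mem _ _ e2)
        · have hd : (desc K l * sig i : B m) = desc K (l+1) := by rw [desc, h5]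
          rw [← map_mul, mul_assoc, hd, map_mul]
          exact JJ_desc m K (l+1) g1 (by omega) _ hu'

lemma HA_le (m : ℕ) : Subalgebra.toSubmodule (HA m) ≤ JJ m (m+1) := by
  have key : ∀ x ∈ HA m, ∀ y ∈ JJ m (m+1), y * x ∈ JJ m (m+1) := by
    intro x hx
    induction hx using Algebra.adjoin_induction with
    | mem x hx =>
      obtain ⟨i, rfl⟩ := hx
      intro y hy
      have := JJ_right m (m+1) le_rfl (i+1) (by omega) (by omega) y hy
      rwa [sig_in i.2] at this
    | algebraMap r =>
      intro y hy
      rw [← Algebra.commutes, ← Algebra.smul_def]; exact Submodule.smul_mem _ _ hy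
    | add x x' _ _ hx hx' => intro y hy; rw [mul_add]; exact add_mem (hx y hy) (hx' y hy)
    | mul x x' _ _ hx hx' => intro y hy; rw [← mul_assoc]; exact hx' _ (hx y hy)
  intro x hx
  have h1 : ∀ K, (1 : H m) ∈ JJ m K := by
    intro K
    induction K with
    | zero => exact Submodule.subset_span ⟨1, rfl, map_one _⟩
    | succ K ih => exact JJ_mono m K ih
  simpa using key x hx 1 (h1 _)

theorem sigma_span (m : ℕ) : Submodule.span R (SigmaSet m) = ⊤ := by
  rw [eq_top_iff, ← WW_top m, WW]
  refine (mul_le_mul' (Ator_le m) (HA_le m)).trans ?_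
  rw [JJ, Submodule.span_mul_span]
  apply Submodule.span_mono
  rintro _ ⟨_, ⟨u, hu, rfl⟩, _, ⟨w, hw, rfl⟩, rfl⟩
  exact (sigma_iff _).2 ⟨u, hu, w, hw, by simp [map_mul]⟩

/-- The set `Σ_n` is a basis of `H_{1,n}(q)` as an `R`-module. -/
theorem sigma_basis (m : ℕ) :
    LinearIndependent R (fun x : SigmaSet m => (x : H m)) ∧
    Submodule.span R (SigmaSet m) = ⊤ :=
  ⟨sigma_li m, sigma_span m⟩

end MB
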